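/- Let p and p̄ be integers with p ≥ 1 and p̄ ≥ 1, let ħ > 0 be real, and let i be an integer with 2i > −(p + 1). Then for every real μ > 0 the function μ ↦ K_i(μ) is differentiable at μ with derivative (p̄·μ^(p̄−1)/ħ) · K_{i+p}(μ). -/

import Mathlib

open MeasureTheory Set

/-- The dual generating function `K_i(μ) = ū_i(μ)` of the `(p, p̄)` family of
solutions of the Toda lattice hierarchy. -/
noncomputable def K (p pb : ℤ) (hbar mu : ℝ) (i : ℤ) : ℝ :=
  ∫ lam in Ioi (0 : ℝ),
    lam ^ (((p : ℝ) - 1) / 2 + (i : ℝ)) *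
      Real.exp (hbar⁻¹ * (lam ^ (p : ℝ) * mu ^ (pb : ℝ) -
        ((p : ℝ) / ((p : ℝ) + (pb : ℝ))) * lam ^ ((p : ℝ) + (pb : ℝ))))

/-- A lower-order perturbation in the exponent costs at most a constant and half of the leading
term. -/
lemma exists_mul_rpow_sub_mul_rpow_le {a b A B : ℝ} (ha : 0 < a) (hab : a < b) (hA : 0 ≤ A)
    (hB : 0 < B) :
    ∃ C : ℝ, ∀ x : ℝ, 0 < x → A * x ^ a - B * x ^ b ≤ C + -(B / 2) * x ^ b := by
  have hlim : Filter.Tendsto (fun T : ℝ => A * T ^ (-(b - a))) Filter.atTop (nhds (A * 0)) :=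
    (tendsto_rpow_neg_atTop (sub_pos.2 hab)).const_mul A
  rw [mul_zero] at hlim
  obtain ⟨T, hT, hTpos⟩ :=
    ((hlim.eventually_le_const (half_pos hB)).and (Filter.eventually_gt_atTop 0)).exists
  refine ⟨A * T ^ a, fun x hx => ?_⟩
  have hxb : 0 < x ^ b := Real.rpow_pos_of_pos hx b
  rcases le_total x T with h | h
  · have h1 : A * x ^ a ≤ A * T ^ a :=
      mul_le_mul_of_nonneg_left (Real.rpow_le_rpow hx.le h ha.le) hA
    nlinarith
  · have h1 : x ^ (-(b - a)) ≤ T ^ (-(b - a)) :=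
      Real.rpow_le_rpow_of_nonpos hTpos h (by linarith)
    have h2 : x ^ a = x ^ (-(b - a)) * x ^ b := by
      rw [← Real.rpow_add hx]
      congr 1
      ring
    have h3 : A * x ^ a ≤ B / 2 * x ^ b := by
      rw [h2, ← mul_assoc]
      exact mul_le_mul_of_nonneg_right ((mul_le_mul_of_nonneg_left h1 hA).trans hT) hxb.le
    have h4 : 0 ≤ A * T ^ a := mul_nonneg hA (Real.rpow_nonneg hTpos.le a)
    linarith

lemma integrableOn_rpow_mul_exp_mul_rpow_sub_mul_rpow {s a b A B : ℝ} (hs : -1 < s) (ha : 0 < a)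
    (hab : a < b) (hA : 0 ≤ A) (hB : 0 < B) :
    IntegrableOn (fun x : ℝ => x ^ s * Real.exp (A * x ^ a - B * x ^ b)) (Ioi 0) := by
  obtain ⟨C, hC⟩ := exists_mul_rpow_sub_mul_rpow_le ha hab hA hB
  refine ((integrableOn_rpow_mul_exp_neg_mul_rpow hs (ha.trans hab) (half_pos hB)).const_mul
    (Real.exp C)).mono' (by fun_prop) ?_
  filter_upwards [ae_restrict_mem measurableSet_Ioi] with x hx
  have hxs : 0 ≤ x ^ s := Real.rpow_nonneg (le_of_lt hx) s
  rw [Real.norm_of_nonneg (by positivity), mul_left_comm, ← Real.exp_add]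
  exact mul_le_mul_of_nonneg_left (Real.exp_le_exp.2 (hC x hx)) hxs

/-- Differentiation under the integral sign for the integrals defining `K`, with real exponents. -/
lemma hasDerivAt_integral_rpow_mul_exp {s a q c h mu : ℝ} (hs : -1 < s) (ha : 0 < a)
    (hq : 1 ≤ q) (hc : 0 < c) (hh : 0 < h) (hmu : 0 < mu) :
    HasDerivAt
      (fun m : ℝ => ∫ x in Ioi (0 : ℝ),
        x ^ s * Real.exp (h⁻¹ * (x ^ a * m ^ q - c * x ^ (a + q))))
      (∫ x in Ioi (0 : ℝ), q * mu ^ (q - 1) / h *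
        (x ^ (s + a) * Real.exp (h⁻¹ * (x ^ a * mu ^ q - c * x ^ (a + q))))) mu := by
  have hint : ∀ t m : ℝ, -1 < t → 0 < m → IntegrableOn
      (fun x : ℝ => x ^ t * Real.exp (h⁻¹ * (x ^ a * m ^ q - c * x ^ (a + q)))) (Ioi 0) := by
    intro t m ht hm
    refine (integrableOn_rpow_mul_exp_mul_rpow_sub_mul_rpow (A := h⁻¹ * m ^ q) (B := h⁻¹ * c)
      (b := a + q) ht ha (by linarith) (by positivity) (by positivity)).congr_fun
      (fun x _ => ?_) measurableSet_Ioi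
    dsimp only
    congr 2
    ring
  refine (hasDerivAt_integral_of_dominated_loc_of_deriv_le
    (μ := volume.restrict (Ioi 0))
    (F := fun m x => x ^ s * Real.exp (h⁻¹ * (x ^ a * m ^ q - c * x ^ (a + q))))
    (F' := fun m x => q * m ^ (q - 1) / h *
        (x ^ (s + a) * Real.exp (h⁻¹ * (x ^ a * m ^ q - c * x ^ (a + q)))))
    (bound := fun x => q * (2 * mu) ^ (q - 1) / h *
        (x ^ (s + a) * Real.exp (h⁻¹ * (x ^ a * (2 * mu) ^ q - c * x ^ (a + q)))))
    (s := Ioo 0 (2 * mu)) (Ioo_mem_nhds hmu (by linarith))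
    (Filter.Eventually.of_forall fun m => by fun_prop) (hint s mu hs hmu) (by fun_prop) ?_
    ((hint (s + a) (2 * mu) (by linarith) (by linarith)).const_mul _) ?_).2
  · filter_upwards [ae_restrict_mem measurableSet_Ioi] with x hx m hm
    have hx0 : (0 : ℝ) < x := hx
    have hm0 : 0 < m := hm.1
    have h1 : m ^ (q - 1) ≤ (2 * mu) ^ (q - 1) :=
      Real.rpow_le_rpow hm0.le hm.2.le (by linarith)
    have h2 : m ^ q ≤ (2 * mu) ^ q := Real.rpow_le_rpow hm0.le hm.2.le (by linarith)
    rw [Real.norm_of_nonneg (by positivity)]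
    gcongr
  · filter_upwards [ae_restrict_mem measurableSet_Ioi] with x hx m hm
    have hderiv := (((((Real.hasDerivAt_rpow_const (p := q) (Or.inl hm.1.ne')).const_mul
      (x ^ a)).sub_const (c * x ^ (a + q))).const_mul h⁻¹).exp).const_mul (x ^ s)
    refine hderiv.congr_deriv ?_
    rw [Real.rpow_add hx s a]
    ring

theorem stmt_8 (p pb : ℤ) (hp : 1 ≤ p) (hpb : 1 ≤ pb)
    (hbar : ℝ) (hhbar : 0 < hbar)
    (i : ℤ) (hi : -(p + 1) < 2 * i) :
    ∀ mu : ℝ, 0 < mu →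
      HasDerivAt (fun m : ℝ => K p pb hbar m i)
        ((pb : ℝ) * mu ^ ((pb : ℝ) - 1) / hbar * K p pb hbar mu (i + p)) mu := by
  intro mu hmu
  have hp' : (1 : ℝ) ≤ p := by exact_mod_cast hp
  have hpb' : (1 : ℝ) ≤ pb := by exact_mod_cast hpb
  have hi' : -((p : ℝ) + 1) < 2 * i := by exact_mod_cast hi
  have hderiv := hasDerivAt_integral_rpow_mul_exp (s := ((p : ℝ) - 1) / 2 + i) (a := p) (q := pb)
    (c := (p : ℝ) / (p + pb)) (by linarith) (by linarith) hpb' (by positivity) hhbar hmu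
  rw [integral_const_mul, add_assoc] at hderiv
  unfold K
  push_cast
  exact hderiv
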